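/- The set U = {z ∈ Z : μ ∈ (μ₋, μ₊), T₊(z) < e, T₋(z) < e, Q(z) < e} is convex. -/

import Mathlib

noncomputable section

open Matrix

abbrev En (n : ℕ) := EuclideanSpace ℝ (Fin n)

/-- The space of symmetric trace-free `n × n` real matrices, as a submodule. -/
def S0 (n : ℕ) : Submodule ℝ (Matrix (Fin n) (Fin n) ℝ) where
  carrier := {σ | σ.IsSymm ∧ σ.trace = 0}
  add_mem' := fun hA hB => ⟨hA.1.add hB.1, by simp [Matrix.trace_add, hA.2, hB.2]⟩
  zero_mem' := ⟨Matrix.isSymm_zero, by simp⟩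
  smul_mem' := fun c A hA => ⟨by rw [Matrix.IsSymm, Matrix.transpose_smul, hA.1], by simp [hA.2]⟩

/-- The state space `Z = ℝ × ℝⁿ × ℝⁿ × S₀ × ℝ`. -/
abbrev Zsp (n : ℕ) := ℝ × En n × En n × ↥(S0 n) × ℝ

/-- Outer product `w ⊗ m`. -/
def op {n : ℕ} (w m : En n) : Matrix (Fin n) (Fin n) ℝ := fun i j => w i * m j

/-- The largest eigenvalue of a (symmetric) matrix, as `sup {ξᵀ A ξ : |ξ| = 1}`. -/
def lamMax {n : ℕ} (A : Matrix (Fin n) (Fin n) ℝ) : ℝ :=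
  sSup {r | ∃ ξ : En n, ‖ξ‖ = 1 ∧ r = ∑ i, ∑ j, ξ i * A i j * ξ j}

/-- The matrix `M(z)`. -/
def Mmat {n : ℕ} (μm μp μ : ℝ) (w m : En n) (σ : Matrix (Fin n) (Fin n) ℝ) :
    Matrix (Fin n) (Fin n) ℝ :=
  (((μp - μ) * (μ - μm))⁻¹) •
      ((μ * μm * μp) • op w w - (μm * μp) • (op m w + op w m) + (μp + μm - μ) • op m m) - σ

/-- `T₊(z)`. -/
def Tp {n : ℕ} (μm μp μ : ℝ) (w m : En n) : ℝ :=
  (μp / (n : ℝ)) * ‖m - μm • w‖ ^ 2 / (μ - μm) ^ 2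

/-- `T₋(z)`. -/
def Tm {n : ℕ} (μm μp μ : ℝ) (w m : En n) : ℝ :=
  (μm / (n : ℝ)) * ‖m - μp • w‖ ^ 2 / (μ - μp) ^ 2

def TpZ {n : ℕ} (μm μp : ℝ) (z : Zsp n) : ℝ := Tp μm μp z.1 z.2.1 z.2.2.1

def TmZ {n : ℕ} (μm μp : ℝ) (z : Zsp n) : ℝ := Tm μm μp z.1 z.2.1 z.2.2.1

def QZ {n : ℕ} (μm μp : ℝ) (z : Zsp n) : ℝ :=
  lamMax (Mmat μm μp z.1 z.2.1 z.2.2.1 (z.2.2.2.1 : Matrix (Fin n) (Fin n) ℝ))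

/-- The open relaxed set `U`. -/
def Uset (n : ℕ) (μm μp e : ℝ) : Set (Zsp n) :=
  {z | z.1 ∈ Set.Ioo μm μp ∧ TpZ μm μp z < e ∧ TmZ μm μp z < e ∧ QZ μm μp z < e}

/-- The constraint set `K`. -/
def Kset (n : ℕ) (μm μp e : ℝ) : Set (Zsp n) :=
  {z | (z.1 = μm ∨ z.1 = μp) ∧ z.2.2.1 = z.1 • z.2.1 ∧
    z.1 • op z.2.1 z.2.1 - (z.2.2.2.1 : Matrix (Fin n) (Fin n) ℝ) =
      e • (1 : Matrix (Fin n) (Fin n) ℝ)}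

/-- The wave cone `Λ`. -/
def Lambda (n : ℕ) : Set (Zsp n) :=
  {z | ¬(z.1 = 0 ∧ z.2.2.1 = 0) ∧
    ∃ (ξ : Fin n → ℝ) (c : ℝ), ¬(ξ = 0 ∧ c = 0) ∧
      ((z.2.2.2.1 : Matrix (Fin n) (Fin n) ℝ) +
          z.2.2.2.2 • (1 : Matrix (Fin n) (Fin n) ℝ)).mulVec ξ + c • (fun i => z.2.2.1 i) = 0 ∧
      (∑ j, z.2.2.1 j * ξ j) + c * z.1 = 0 ∧
      (∑ j, z.2.1 j * ξ j) = 0}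

/-- The projection `π(μ, w, m, σ, q) = (μ, w, m, σ)`. -/
def pz {n : ℕ} (z : Zsp n) : ℝ × En n × En n × ↥(S0 n) := (z.1, z.2.1, z.2.2.1, z.2.2.2.1)

/-- The quadratic form `ξᵀ A ξ`. -/
def quadForm {n : ℕ} (A : Matrix (Fin n) (Fin n) ℝ) (ξ : En n) : ℝ :=
  ∑ i, ∑ j, ξ i * A i j * ξ j

/-- The Euclidean pairing `w · ξ` in coordinates. -/
def pairing {n : ℕ} (w ξ : En n) : ℝ := ∑ i, w i * ξ i

section QuadForm

variable {n : ℕ}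

lemma quadForm_add (A B : Matrix (Fin n) (Fin n) ℝ) (ξ : En n) :
    quadForm (A + B) ξ = quadForm A ξ + quadForm B ξ := by
  simp [quadForm, mul_add, add_mul, Finset.sum_add_distrib]

lemma quadForm_smul (c : ℝ) (A : Matrix (Fin n) (Fin n) ℝ) (ξ : En n) :
    quadForm (c • A) ξ = c * quadForm A ξ := by
  simp only [quadForm, Finset.mul_sum, Matrix.smul_apply, smul_eq_mul]
  exact Finset.sum_congr rfl fun i _ => Finset.sum_congr rfl fun j _ => by ring

lemma quadForm_sub (A B : Matrix (Fin n) (Fin n) ℝ) (ξ : En n) :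
    quadForm (A - B) ξ = quadForm A ξ - quadForm B ξ := by
  simp [quadForm, mul_sub, sub_mul, Finset.sum_sub_distrib]

lemma quadForm_op (w m ξ : En n) : quadForm (op w m) ξ = pairing w ξ * pairing m ξ := by
  simp only [quadForm, pairing, op, Finset.sum_mul_sum]
  exact Finset.sum_congr rfl fun i _ => Finset.sum_congr rfl fun j _ => by ring

lemma pairing_add (v w ξ : En n) : pairing (v + w) ξ = pairing v ξ + pairing w ξ := by
  simp [pairing, add_mul, Finset.sum_add_distrib]

lemma pairing_smul (c : ℝ) (w ξ : En n) : pairing (c • w) ξ = c * pairing w ξ := by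
  simp [pairing, Finset.mul_sum, mul_assoc]

lemma bddAbove_quadForm (A : Matrix (Fin n) (Fin n) ℝ) :
    BddAbove {r | ∃ ξ : En n, ‖ξ‖ = 1 ∧ r = ∑ i, ∑ j, ξ i * A i j * ξ j} := by
  refine ⟨∑ i, ∑ j, |A i j|, ?_⟩
  rintro r ⟨ξ, hξ, rfl⟩
  have h1 (i : Fin n) : |ξ i| ≤ 1 := by
    simpa [hξ] using PiLp.norm_apply_le ξ i
  refine Finset.sum_le_sum fun i _ => Finset.sum_le_sum fun j _ => ?_
  calc ξ i * A i j * ξ j ≤ |ξ i * A i j * ξ j| := le_abs_self _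
    _ = |ξ i| * |A i j| * |ξ j| := by rw [abs_mul, abs_mul]
    _ ≤ 1 * |A i j| * 1 := by gcongr <;> exact h1 _
    _ = |A i j| := by ring

lemma quadForm_le_lamMax (A : Matrix (Fin n) (Fin n) ℝ) {ξ : En n} (hξ : ‖ξ‖ = 1) :
    quadForm A ξ ≤ lamMax A :=
  le_csSup (bddAbove_quadForm A) ⟨ξ, hξ, rfl⟩

lemma lamMax_le (hn : 0 < n) (A : Matrix (Fin n) (Fin n) ℝ) {c : ℝ}
    (h : ∀ ξ : En n, ‖ξ‖ = 1 → quadForm A ξ ≤ c) : lamMax A ≤ c := by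
  refine csSup_le ⟨_, EuclideanSpace.single ⟨0, hn⟩ 1, by simp, rfl⟩ ?_
  rintro r ⟨ξ, hξ, rfl⟩
  exact h ξ hξ

/-- The quadratic form of `M(z)` is a positive combination of two quadratic-over-linear terms
plus a linear term. -/
lemma quadForm_Mmat {μm μp μ : ℝ} (hμ : μ ∈ Set.Ioo μm μp) (w m : En n)
    (σ : Matrix (Fin n) (Fin n) ℝ) (ξ : En n) :
    quadForm (Mmat μm μp μ w m σ) ξ =
      μp / (μp - μm) * ((pairing m ξ - μm * pairing w ξ) ^ 2 / (μ - μm)) +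
      μm / (μp - μm) * ((μp * pairing w ξ - pairing m ξ) ^ 2 / (μp - μ)) - quadForm σ ξ := by
  have h1 : μ - μm ≠ 0 := (sub_pos.2 hμ.1).ne'
  have h2 : μp - μ ≠ 0 := (sub_pos.2 hμ.2).ne'
  have h3 : μp - μm ≠ 0 := (sub_pos.2 (hμ.1.trans hμ.2)).ne'
  simp only [Mmat, quadForm_sub, quadForm_add, quadForm_smul, quadForm_op]
  field_simp
  ring

end QuadForm

/-- Joint convexity of `(x, s) ↦ x ^ 2 / s`, in homogeneous form. -/
lemma sq_div_combo_le {a b s t : ℝ} (x y : ℝ) (ha : 0 ≤ a) (hb : 0 ≤ b) (hs : 0 < s)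
    (ht : 0 < t) (hst : 0 < a * s + b * t) :
    (a * x + b * y) ^ 2 / (a * s + b * t) ≤ a * (x ^ 2 / s) + b * (y ^ 2 / t) := by
  rw [div_le_iff₀ hst]
  have key : (a * (x ^ 2 / s) + b * (y ^ 2 / t)) * (a * s + b * t) - (a * x + b * y) ^ 2 =
      a * b * ((x * t - y * s) ^ 2 / (s * t)) := by
    field_simp
    ring
  have : 0 ≤ a * b * ((x * t - y * s) ^ 2 / (s * t)) := by positivity
  linarith

lemma combo_pos {a b s t : ℝ} (ha : 0 ≤ a) (hb : 0 ≤ b) (hab : a + b = 1) (hs : 0 < s)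
    (ht : 0 < t) : 0 < a * s + b * t :=
  convex_Ioi (0 : ℝ) hs ht ha hb hab

/-- The sublevel condition `c ‖x‖ ^ 2 / d ^ 2 < e` is convex in `(x, d)` on `d > 0`. -/
lemma mul_norm_sq_div_sq_combo_lt {E : Type*} [SeminormedAddCommGroup E] [NormedSpace ℝ E]
    {a b c d₁ d₂ e : ℝ} {x₁ x₂ : E} (ha : 0 ≤ a) (hb : 0 ≤ b) (hab : a + b = 1)
    (hc : 0 ≤ c) (hd₁ : 0 < d₁) (hd₂ : 0 < d₂) (he : 0 ≤ e)
    (h₁ : c * ‖x₁‖ ^ 2 / d₁ ^ 2 < e) (h₂ : c * ‖x₂‖ ^ 2 / d₂ ^ 2 < e) :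
    c * ‖a • x₁ + b • x₂‖ ^ 2 / (a * d₁ + b * d₂) ^ 2 < e := by
  have key {x : E} {d : ℝ} (hd : 0 < d) :
      c * ‖x‖ ^ 2 / d ^ 2 < e ↔ 0 < √e * d - √c * ‖x‖ := by
    rw [div_lt_iff₀ (by positivity), sub_pos,
      ← pow_lt_pow_iff_left₀ (a := √c * ‖x‖) (by positivity) (by positivity) two_ne_zero,
      mul_pow, mul_pow, Real.sq_sqrt hc, Real.sq_sqrt he]
  rw [key (combo_pos ha hb hab hd₁ hd₂)]
  have hpos := combo_pos ha hb hab ((key hd₁).1 h₁) ((key hd₂).1 h₂)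
  have hnorm : ‖a • x₁ + b • x₂‖ ≤ a * ‖x₁‖ + b * ‖x₂‖ := by
    simpa [norm_smul, abs_of_nonneg ha, abs_of_nonneg hb] using norm_add_le (a • x₁) (b • x₂)
  have := mul_le_mul_of_nonneg_left hnorm (Real.sqrt_nonneg c)
  linarith

/-- The set
`U = {z ∈ Z : μ ∈ (μ₋, μ₊), T₊(z) < e, T₋(z) < e, Q(z) < e}` is convex. -/
theorem U_convex (n : ℕ) (hn : 2 ≤ n) (μm μp : ℝ) (hμm : 0 < μm) (hμ : μm < μp)
    (e : ℝ) (he : 0 < e) : Convex ℝ (Uset n μm μp e) := by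
  rintro ⟨μ₁, w₁, m₁, σ₁, q₁⟩ ⟨hμ₁, hp₁, hm₁, hQ₁⟩ ⟨μ₂, w₂, m₂, σ₂, q₂⟩ ⟨hμ₂, hp₂, hm₂, hQ₂⟩
    a b ha hb hab
  simp only [TpZ, TmZ, QZ, Tp, Tm] at hμ₁ hμ₂ hp₁ hp₂ hm₁ hm₂ hQ₁ hQ₂
  have hμp : 0 < μp := hμm.trans hμ
  have hμ₃ : a * μ₁ + b * μ₂ ∈ Set.Ioo μm μp := convex_Ioo μm μp hμ₁ hμ₂ ha hb hab
  have hlow : a * μ₁ + b * μ₂ - μm = a * (μ₁ - μm) + b * (μ₂ - μm) := by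
    linear_combination μm * hab
  have hupp : μp - (a * μ₁ + b * μ₂) = a * (μp - μ₁) + b * (μp - μ₂) := by
    linear_combination -μp * hab
  have hvec (c : ℝ) : a • m₁ + b • m₂ - c • (a • w₁ + b • w₂) =
      a • (m₁ - c • w₁) + b • (m₂ - c • w₂) := by
    module
  have hl₁ := sub_pos.2 hμ₁.1
  have hl₂ := sub_pos.2 hμ₂.1
  have hu₁ := sub_pos.2 hμ₁.2
  have hu₂ := sub_pos.2 hμ₂.2
  refine ⟨hμ₃, ?_, ?_, ?_⟩
  · change μp / n * ‖a • m₁ + b • m₂ - μm • (a • w₁ + b • w₂)‖ ^ 2 /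
      (a * μ₁ + b * μ₂ - μm) ^ 2 < e
    rw [hvec, hlow]
    exact mul_norm_sq_div_sq_combo_lt ha hb hab (by positivity) hl₁ hl₂ he.le hp₁ hp₂
  · change μm / n * ‖a • m₁ + b • m₂ - μp • (a • w₁ + b • w₂)‖ ^ 2 /
      (a * μ₁ + b * μ₂ - μp) ^ 2 < e
    rw [sub_sq_comm] at hm₁ hm₂ ⊢
    rw [hvec, hupp]
    exact mul_norm_sq_div_sq_combo_lt ha hb hab (by positivity) hu₁ hu₂ he.le hm₁ hm₂
  · change lamMax (Mmat μm μp (a * μ₁ + b * μ₂) (a • w₁ + b • w₂) (a • m₁ + b • m₂)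
      (a • (σ₁ : Matrix (Fin n) (Fin n) ℝ) + b • (σ₂ : Matrix (Fin n) (Fin n) ℝ))) < e
    refine (lamMax_le (by lia) _ fun ξ hξ => ?_).trans_lt
      (convex_Iio e hQ₁ hQ₂ ha hb hab)
    have h₁ := mul_le_mul_of_nonneg_left (quadForm_le_lamMax _ hξ) ha (b := quadForm
      (Mmat μm μp μ₁ w₁ m₁ (σ₁ : Matrix (Fin n) (Fin n) ℝ)) ξ)
    have h₂ := mul_le_mul_of_nonneg_left (quadForm_le_lamMax _ hξ) hb (b := quadForm
      (Mmat μm μp μ₂ w₂ m₂ (σ₂ : Matrix (Fin n) (Fin n) ℝ)) ξ)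
    refine le_trans ?_ (add_le_add h₁ h₂)
    simp only [quadForm_Mmat hμ₁, quadForm_Mmat hμ₂, quadForm_Mmat hμ₃, quadForm_add,
      quadForm_smul, pairing_add, pairing_smul, hlow, hupp]
    have hδ : 0 < μp - μm := sub_pos.2 hμ
    have hA := mul_le_mul_of_nonneg_left
      (sq_div_combo_le (pairing m₁ ξ - μm * pairing w₁ ξ) (pairing m₂ ξ - μm * pairing w₂ ξ)
        ha hb hl₁ hl₂ (combo_pos ha hb hab hl₁ hl₂)) (div_pos hμp hδ).le
    have hB := mul_le_mul_of_nonneg_left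
      (sq_div_combo_le (μp * pairing w₁ ξ - pairing m₁ ξ) (μp * pairing w₂ ξ - pairing m₂ ξ)
        ha hb hu₁ hu₂ (combo_pos ha hb hab hu₁ hu₂)) (div_pos hμm hδ).le
    rw [show a * pairing m₁ ξ + b * pairing m₂ ξ - μm * (a * pairing w₁ ξ + b * pairing w₂ ξ) =
      a * (pairing m₁ ξ - μm * pairing w₁ ξ) + b * (pairing m₂ ξ - μm * pairing w₂ ξ) by ring,
      show μp * (a * pairing w₁ ξ + b * pairing w₂ ξ) - (a * pairing m₁ ξ + b * pairing m₂ ξ) =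
      a * (μp * pairing w₁ ξ - pairing m₁ ξ) + b * (μp * pairing w₂ ξ - pairing m₂ ξ) by ring]
    linarith
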